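/- Let f be in the class C(φ). Then the third Hankel determinant satisfies |a₃(a₂a₄ − a₃²) − a₄(a₄ − a₂a₃) + a₅(a₃ − a₂²)| ≤ 1/144, where aₙ denotes the n-th Taylor coefficient of f at 0. -/

import Mathlib

open Metric

/-- The majorant of the Hankel determinant when the third Schur parameter has modulus one;
`u` and `y` stand for `|γ₀|²` and `|γ₁|`. -/
theorem majorant_le_one_at_one (u y : ℝ) (hu0 : 0 ≤ u) (hu1 : u ≤ 1) (hy0 : 0 ≤ y) (hy1 : y ≤ 1) :
    7/80*u*y + y^2*(17/160+u/5) + 3/10*y^3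
      + (1-y^2)*(u/5 + (u+y^2)/10 + 7/10*u*y + y^2/5) + (1-u)*(1-4/5*y^2) ≤ 1 := by
  have h0 : y^2*(17/160) + 3/10*y^3 + (1-y^2)*(3/10*y^2) + (1-4/5*y^2) ≤ 1 := by
    nlinarith [mul_nonneg (sq_nonneg y) hy0, mul_nonneg (sq_nonneg y) (sub_nonneg.2 hy1),
      sq_nonneg (y^2)]
  have h1 : 7/80*y + y^2*(49/160) + 3/10*y^3 + (1-y^2)*(3/10+3/10*y^2+7/10*y) ≤ 1 := by
    nlinarith [mul_nonneg (sq_nonneg y) hy0, mul_nonneg (sq_nonneg y) (sub_nonneg.2 hy1),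
      sq_nonneg (y^2), mul_nonneg hy0 (sq_nonneg (y-1/2)), sq_nonneg (y-1/2), sq_nonneg (y^2-1/2)]
  nlinarith [mul_le_mul_of_nonneg_left h0 (sub_nonneg.2 hu1), mul_le_mul_of_nonneg_left h1 hu0]

/-- The majorant of the Hankel determinant when the third Schur parameter vanishes. -/
theorem majorant_le_one_at_zero (u y : ℝ) (hu0 : 0 ≤ u) (hu1 : u ≤ 1) (hy0 : 0 ≤ y) (hy1 : y ≤ 1) :
    7/80*u*y + y^2*(17/160+u/5) + 3/10*y^3
      + (1-y^2)*(u/5 + (u+y^2)/10 + 4/10*u*y + y^2/5)/2 + (1-y^2)*(6/5*(1-u)*y+3/10*u) ≤ 1 := by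
  have h0 : y^2*(17/160) + 3/10*y^3 + (1-y^2)*(3/10*y^2)/2 + (1-y^2)*(6/5*y) ≤ 1 := by
    nlinarith [mul_nonneg (sq_nonneg y) hy0, mul_nonneg (sq_nonneg y) (sub_nonneg.2 hy1),
      sq_nonneg (y^2), mul_nonneg hy0 (sq_nonneg (y-1/2)), sq_nonneg (y-1/2), sq_nonneg (y^2-1/2)]
  have h1 : 7/80*y + y^2*(49/160) + 3/10*y^3 + (1-y^2)*(3/10+3/10*y^2+4/10*y)/2 
      + (1-y^2)*(3/10) ≤ 1 := by
    nlinarith [mul_nonneg (sq_nonneg y) hy0, mul_nonneg (sq_nonneg y) (sub_nonneg.2 hy1),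
      sq_nonneg (y^2), mul_nonneg hy0 (sq_nonneg (y-1/2)), sq_nonneg (y-1/2), sq_nonneg (y^2-1/2)]
  nlinarith [mul_le_mul_of_nonneg_left h0 (sub_nonneg.2 hu1), mul_le_mul_of_nonneg_left h1 hu0]

theorem constant_term_le (x y : ℝ) (hx0 : 0 ≤ x) (hx1 : x ≤ 1) (hy0 : 0 ≤ y) (hy1 : y ≤ 1) :
    7/80*x^4*y + x^2*y^2*(x^2/5+17/40*(1-x^2)) + 3/10*y^3 + (1-x^2)/5*x^2*y^4
      ≤ 7/80*x^2*y + y^2*(17/160+x^2/5) + 3/10*y^3 := by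
  have hx2 : x^2 ≤ 1 := pow_le_one₀ hx0 hx1
  have hy2 : y^2 ≤ 1 := pow_le_one₀ hy0 hy1
  have h1 : 0 ≤ x^2*y*(1-x^2) := by have := sub_nonneg.2 hx2; positivity
  have h2 : 0 ≤ (1-x^2)*x^2*y^2*(1-y^2) := by
    have := sub_nonneg.2 hx2; have := sub_nonneg.2 hy2; positivity
  nlinarith [mul_nonneg (sq_nonneg y) (sq_nonneg (x^2-1/2))]

theorem linear_coefficient_le (x y : ℝ) (hx0 : 0 ≤ x) (hx1 : x ≤ 1) (hy0 : 0 ≤ y) :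
    x^3/5 + x*y*((1-x^2)/5+3/5*x^2) + 2/5*(1-x^2)*x*y^2
      ≤ x^2/5 + (x^2+y^2)/10 + 2/5*x^2*y + y^2/5 := by
  have h1 : 0 ≤ x^2*(1-x) := by have := sub_nonneg.2 hx1; positivity
  have h2 : 0 ≤ x^2*(1-x)*y := by have := sub_nonneg.2 hx1; positivity
  have h3 : 2*(1-x^2)*x ≤ 1 := by
    nlinarith [sq_nonneg (x-1), sq_nonneg (x-1/2), mul_nonneg hx0 (sq_nonneg (x-1/2))]
  nlinarith [mul_le_mul_of_nonneg_right h3 (sq_nonneg y), sq_nonneg (x-y)]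

/-- The triangle-inequality majorant of `144 H₃(1)` in terms of the moduli of the first three
Schur parameters. -/
theorem schur_majorant_le_one (x y t : ℝ) (hx0 : 0 ≤ x) (hx1 : x ≤ 1) (hy0 : 0 ≤ y) (hy1 : y ≤ 1)
    (ht0 : 0 ≤ t) (ht1 : t ≤ 1) :
    7/480*x^6 + (1-x^2)*(7/80*x^4*y + x^2*y^2*(x^2/5+17/40*(1-x^2)) + 3/10*y^3
        + (1-x^2)/5*x^2*y^4
      + (1-y^2)*(x^3/5 + x*y*((1-x^2)/5+3/5*x^2) + 2/5*(1-x^2)*x*y^2)*t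
      + (1-y^2)*((1-x^2)*(1+y^2/5)+3/10*y*x^2)*t^2
      + (1-y^2)*(1-t^2)*(6/5*(1-x^2)*y+3/10*x^2)) ≤ 1 := by
  have hx2 : x^2 ≤ 1 := pow_le_one₀ hx0 hx1
  have hP : 0 ≤ 1 - x^2 := sub_nonneg.2 hx2
  have hQ : 0 ≤ 1 - y^2 := sub_nonneg.2 (pow_le_one₀ hy0 hy1)
  have ht2 : 0 ≤ 1 - t^2 := sub_nonneg.2 (pow_le_one₀ ht0 ht1)
  have hA := majorant_le_one_at_one (x^2) y (sq_nonneg x) hx2 hy0 hy1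
  have hB := majorant_le_one_at_zero (x^2) y (sq_nonneg x) hx2 hy0 hy1
  have h0 := constant_term_le x y hx0 hx1 hy0 hy1
  have h1 := linear_coefficient_le x y hx0 hx1 hy0
  set K := x^3/5 + x*y*((1-x^2)/5+3/5*x^2) + 2/5*(1-x^2)*x*y^2 with hK
  set L := 7/80*x^4*y + x^2*y^2*(x^2/5+17/40*(1-x^2)) + 3/10*y^3 + (1-x^2)/5*x^2*y^4 with hL
  have hK0 : 0 ≤ K := by positivity
  have h1' := mul_le_mul_of_nonneg_left h1 hQ
  have ht : (1-y^2)*K*t ≤ (1-y^2)*K*((1+t^2)/2) :=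
    mul_le_mul_of_nonneg_left (by nlinarith [sq_nonneg (t-1)]) (mul_nonneg hQ hK0)
  have e2 : (1-y^2)*((1-x^2)*(1+y^2/5)+3/10*y*x^2) ≤
      (1-x^2)*(1-4/5*y^2) + (1-y^2)*(3/10*x^2*y) := by
    nlinarith [mul_nonneg hP (sq_nonneg (y^2))]
  have hone : L + (1-y^2)*K + (1-y^2)*((1-x^2)*(1+y^2/5)+3/10*y*x^2) ≤ 1 := by
    linarith
  have hzero : L + (1-y^2)*K/2 + (1-y^2)*(6/5*(1-x^2)*y+3/10*x^2) ≤ 1 := by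
    linarith
  have hM : L + (1-y^2)*K*t + (1-y^2)*((1-x^2)*(1+y^2/5)+3/10*y*x^2)*t^2
      + (1-y^2)*(1-t^2)*(6/5*(1-x^2)*y+3/10*x^2) ≤ 1 := by
    linarith [mul_le_mul_of_nonneg_left hone (sq_nonneg t), mul_le_mul_of_nonneg_left hzero ht2]
  have hx6 : x^6 ≤ x^2 := pow_le_pow_of_le_one hx0 hx1 (by norm_num)
  linarith [mul_le_mul_of_nonneg_left hM hP, sq_nonneg x]

/-- The bound for `144 H₃(1)` written in the Schur parameters `g, h, k, l` of `ω(z)/z`. -/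
theorem norm_schur_expression_le_one (g h k l : ℂ) (hg : ‖g‖ ≤ 1) (hh : ‖h‖ ≤ 1) (hk : ‖k‖ ≤ 1)
    (hl : ‖l‖ ≤ 1) :
    ‖-(7/480)*g^6 + (1 - star g * g)*(7/80*g^4*h
      - g^2*h^2*(star g * g/5+17/40*(1 - star g * g))
      + h^3*(7/30*(1 - star g * g)^2 - 1/5*(star g * g)*(1 - star g * g) - 3/10*(star g * g)^2)
      + (1 - star g * g)/5*star g^2*h^4
      + (1 - star h * h)*(g^3/5 + g*h*((1 - star g * g)/5+3/5*(star g * g))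
          - 2/5*(1 - star g * g)*star g*h^2)*k
      - (1 - star h * h)*((1 - star g * g)*(1+star h * h/5)-3/10*star h*g^2)*k^2
      + (1 - star h * h)*(1 - star k * k)*(6/5*(1 - star g * g)*h-3/10*g^2)*l)‖ ≤ 1 := by
  have hs : ∀ z : ℂ, star z * z = ((‖z‖^2 : ℝ) : ℂ) := fun z => by
    rw [Complex.ofReal_pow]; exact Complex.conj_mul' z
  refine le_trans ?_ (schur_majorant_le_one ‖g‖ ‖h‖ ‖k‖ (norm_nonneg _) hg (norm_nonneg _) hh
    (norm_nonneg _) hk)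
  have hP : 0 ≤ 1 - ‖g‖^2 := sub_nonneg.2 (pow_le_one₀ (norm_nonneg _) hg)
  have hQ : 0 ≤ 1 - ‖h‖^2 := sub_nonneg.2 (pow_le_one₀ (norm_nonneg _) hh)
  have hR : 0 ≤ 1 - ‖k‖^2 := sub_nonneg.2 (pow_le_one₀ (norm_nonneg _) hk)
  have hn : ∀ r : ℝ, 0 ≤ r → ‖(r:ℂ)‖ = r := fun r hr => by simp [abs_of_nonneg hr]
  have hPn := hn _ hP
  have hQn := hn _ hQ
  have hRn := hn _ hR
  push_cast at hPn hQn hRn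
  have h3 : ‖7/30*(1 - (‖g‖:ℂ)^2)^2 - 1/5*(‖g‖:ℂ)^2*(1 - (‖g‖:ℂ)^2)
      - 3/10*((‖g‖:ℂ)^2)^2‖ ≤ 3/10 := by
    have : 7/30*(1 - (‖g‖:ℂ)^2)^2 - 1/5*(‖g‖:ℂ)^2*(1 - (‖g‖:ℂ)^2) - 3/10*((‖g‖:ℂ)^2)^2
        = ((7/30*(1 - ‖g‖^2)^2 - 1/5*‖g‖^2*(1 - ‖g‖^2) - 3/10*(‖g‖^2)^2 : ℝ) : ℂ) := by
      push_cast
      ring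
    rw [this, Complex.norm_real, Real.norm_eq_abs, abs_le]
    constructor <;> nlinarith [sq_nonneg ‖g‖, mul_nonneg hP (sq_nonneg ‖g‖)]
  have h2 := hn (‖g‖^2/5+17/40*(1 - ‖g‖^2)) (by positivity)
  have h4 := hn ((1 - ‖g‖^2)/5+3/5*‖g‖^2) (by positivity)
  have h5 := hn ((1 - ‖g‖^2)*(1+‖h‖^2/5)) (by positivity)
  push_cast at h2 h4 h5
  rw [hs g, hs h, hs k]
  push_cast
  refine (norm_add_le _ _).trans (add_le_add (by simp) ?_)
  rw [norm_mul, hPn]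
  refine mul_le_mul_of_nonneg_left ?_ hP
  refine (norm_add_le _ _).trans (add_le_add ((norm_sub_le _ _).trans (add_le_add
    ((norm_add_le _ _).trans (add_le_add ((norm_add_le _ _).trans (add_le_add
    ((norm_add_le _ _).trans (add_le_add ((norm_sub_le _ _).trans (add_le_add ?_ ?_)) ?_)) ?_))
    ?_)) ?_)) ?_)
  · simp
  · simp [h2]
  · rw [norm_mul, norm_pow, mul_comm]
    exact mul_le_mul_of_nonneg_right h3 (by positivity)
  · simp [hPn]
  · rw [norm_mul, norm_mul, hQn]
    gcongr
    refine (norm_sub_le _ _).trans (add_le_add ((norm_add_le _ _).trans (add_le_add ?_ ?_)) ?_)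
    · simp
    · simp [h4]
    · simp [hPn]
  · rw [norm_mul, norm_mul, norm_pow, hQn]
    gcongr
    refine (norm_sub_le _ _).trans (add_le_add h5.le ?_)
    simp
  · rw [norm_mul, norm_mul, norm_mul, hQn, hRn]
    refine (mul_le_of_le_one_right (by positivity) hl).trans ?_
    gcongr
    refine (norm_sub_le _ _).trans (add_le_add ?_ ?_)
    · simp [hPn]
    · simp

/-- One step of Schur's algorithm. If `|g 0| = 1` then `g` is constant and `h = 0` works. -/
theorem exists_schur_step (g : ℂ → ℂ) (hg : DifferentiableOn ℂ g (ball 0 1))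
    (hg1 : ∀ z ∈ ball (0:ℂ) 1, ‖g z‖ ≤ 1) :
    ∃ h : ℂ → ℂ, DifferentiableOn ℂ h (ball 0 1) ∧ (∀ z ∈ ball (0:ℂ) 1, ‖h z‖ ≤ 1) ∧
      ∀ z ∈ ball (0:ℂ) 1, g z - g 0 = z * h z * (1 - star (g 0) * g z) := by
  have h0 : (0:ℂ) ∈ ball (0:ℂ) 1 := mem_ball_self one_pos
  rcases (hg1 0 h0).eq_or_lt with he | hlt
  · refine ⟨fun _ => 0, differentiableOn_const _, by simp, fun z hz => ?_⟩
    have hmax : IsMaxOn (norm ∘ g) (ball 0 1) 0 := fun w hw => by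
      simpa [he] using hg1 w hw
    have := Complex.eqOn_of_isPreconnected_of_isMaxOn_norm
      (convex_ball (0:ℂ) 1).isPreconnected isOpen_ball hg h0 hmax hz
    simp [this]
  · have hden : ∀ z ∈ ball (0:ℂ) 1, 1 - star (g 0) * g z ≠ 0 := fun z hz he => by
      have h1 : ‖star (g 0) * g z‖ = 1 := by rw [← sub_eq_zero.1 he, norm_one]
      rw [norm_mul, norm_star] at h1
      nlinarith [norm_nonneg (g z), norm_nonneg (g 0), hg1 z hz]
    let k : ℂ → ℂ := fun z => (g z - g 0) / (1 - star (g 0) * g z)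
    have hk : DifferentiableOn ℂ k (ball 0 1) :=
      (hg.sub_const _).div ((differentiableOn_const _).sub (hg.const_mul _)) hden
    have hk0 : k 0 = 0 := by simp [k]
    have hmaps : Set.MapsTo k (ball 0 1) (closedBall (k 0) 1) := fun z hz => by
      rw [hk0, mem_closedBall_zero_iff, norm_div,
        div_le_one (norm_pos_iff.2 (hden z hz)), ← sq_le_sq₀ (norm_nonneg _) (norm_nonneg _)]
      have h1 := hg1 z hz
      have h2 : ‖1 - star (g 0) * g z‖ ^ 2 - ‖g z - g 0‖ ^ 2
          = (1 - ‖g 0‖ ^ 2) * (1 - ‖g z‖ ^ 2) := by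
        simp only [Complex.sq_norm, Complex.normSq_apply]
        simp
        ring
      have h3 : ‖g z‖ ^ 2 ≤ 1 := pow_le_one₀ (norm_nonneg _) h1
      have h4 : ‖g 0‖ ^ 2 ≤ 1 := pow_le_one₀ (norm_nonneg _) hlt.le
      nlinarith
    refine ⟨dslope k 0, (Complex.differentiableOn_dslope (ball_mem_nhds _ one_pos)).2 hk,
      fun z hz => ?_, fun z hz => ?_⟩
    · simpa using Complex.norm_dslope_le_div_of_mapsTo_ball hk hmaps hz
    · have := sub_smul_dslope k 0 z
      rw [sub_zero, hk0, sub_zero, smul_eq_mul] at this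
      rw [this, div_mul_cancel₀ _ (hden z hz)]

/-- The Taylor series at the origin of a function, as a formal power series. -/
noncomputable def taylorPowerSeries (g : ℂ → ℂ) : PowerSeries ℂ :=
  PowerSeries.mk fun n => iteratedDeriv n g 0 / n.factorial

theorem taylorPowerSeries_mul {g h : ℂ → ℂ} (hg : AnalyticAt ℂ g 0) (hh : AnalyticAt ℂ h 0) :
    taylorPowerSeries (g * h) = taylorPowerSeries g * taylorPowerSeries h := by
  ext n
  rw [PowerSeries.coeff_mul, taylorPowerSeries, PowerSeries.coeff_mk,
    iteratedDeriv_mul hg.contDiffAt hh.contDiffAt,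
    Finset.Nat.sum_antidiagonal_eq_sum_range_succ_mk, Finset.sum_div]
  refine Finset.sum_congr rfl fun i hi => ?_
  have hi' : i ≤ n := Nat.lt_succ_iff.1 (Finset.mem_range.1 hi)
  simp only [taylorPowerSeries, PowerSeries.coeff_mk]
  rw [Nat.cast_choose ℂ hi']
  have : (n.factorial : ℂ) ≠ 0 := Nat.cast_ne_zero.2 n.factorial_ne_zero
  field_simp

theorem taylorPowerSeries_add {g h : ℂ → ℂ} (hg : AnalyticAt ℂ g 0) (hh : AnalyticAt ℂ h 0) :
    taylorPowerSeries (g + h) = taylorPowerSeries g + taylorPowerSeries h := by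
  ext n
  simp [taylorPowerSeries, iteratedDeriv_add hg.contDiffAt hh.contDiffAt, add_div]

theorem taylorPowerSeries_const (c : ℂ) : taylorPowerSeries (fun _ => c) = PowerSeries.C c := by
  ext n
  rcases n with _ | n <;> simp [taylorPowerSeries, PowerSeries.coeff_C, iteratedDeriv_const]

theorem taylorPowerSeries_id : taylorPowerSeries id = PowerSeries.X := by
  ext n
  rcases n with _ | _ | n <;>
    simp [taylorPowerSeries, PowerSeries.coeff_X, iteratedDeriv_succ', iteratedDeriv_const]

theorem taylorPowerSeries_deriv (g : ℂ → ℂ) :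
    taylorPowerSeries (deriv g) = PowerSeries.derivative ℂ (taylorPowerSeries g) := by
  ext n
  rw [PowerSeries.coeff_derivative]
  simp only [taylorPowerSeries, PowerSeries.coeff_mk, iteratedDeriv_succ', Nat.factorial_succ]
  have := Nat.factorial_ne_zero n
  have : (n:ℂ) + 1 ≠ 0 := Nat.cast_add_one_ne_zero n
  push_cast
  field_simp

theorem taylorPowerSeries_congr {g h : ℂ → ℂ} (H : ∀ z ∈ ball (0:ℂ) 1, g z = h z) :
    taylorPowerSeries g = taylorPowerSeries h := by
  ext n
  have : g =ᶠ[nhds 0] h := Filter.eventually_of_mem (ball_mem_nhds _ one_pos) H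
  simp [taylorPowerSeries, this.iteratedDeriv_eq n]

theorem coeff_taylorPowerSeries_of_hasSum {g : ℂ → ℂ} {a : ℕ → ℂ}
    (ha : ∀ z ∈ ball (0:ℂ) 1, HasSum (fun n => a n * z ^ n) (g z)) (n : ℕ) :
    PowerSeries.coeff n (taylorPowerSeries g) = a n := by
  have h1 : HasFPowerSeriesAt g (FormalMultilinearSeries.ofScalars ℂ a) 0 := by
    rw [hasFPowerSeriesAt_iff]
    filter_upwards [ball_mem_nhds (0:ℂ) one_pos] with z hz
    simpa [FormalMultilinearSeries.coeff_ofScalars, mul_comm] using ha z hz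
  have h2 := h1.eq_formalMultilinearSeries h1.analyticAt.hasFPowerSeriesAt
  have h3 := (FormalMultilinearSeries.ofScalars_series_eq_iff ℂ _ _).1 h2
  simp [taylorPowerSeries, h3]

theorem taylorPowerSeries_of_schur_step {g h : ℂ → ℂ} (hg : AnalyticAt ℂ g 0)
    (hh : AnalyticAt ℂ h 0)
    (H : ∀ z ∈ ball (0:ℂ) 1, g z - g 0 = z * h z * (1 - star (g 0) * g z)) :
    taylorPowerSeries g = PowerSeries.C (g 0) +
      PowerSeries.X * (taylorPowerSeries h *
        (1 - PowerSeries.C (star (g 0)) * taylorPowerSeries g)) := by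
  have hc : ∀ c : ℂ, AnalyticAt ℂ (fun _ : ℂ => c) 0 := fun c => analyticAt_const
  have key : taylorPowerSeries g = taylorPowerSeries ((fun _ => g 0) +
      id * (h * ((fun _ => 1) + (fun _ => -star (g 0)) * g))) :=
    taylorPowerSeries_congr fun z hz => by
      have := H z hz
      simp only [Pi.add_apply, Pi.mul_apply, id]
      linear_combination this
  have h1 := (hc (-star (g 0))).mul hg
  have h2 := (hc 1).add h1
  conv_lhs => rw [key]
  rw [taylorPowerSeries_add (hc _) (analyticAt_id.mul (hh.mul h2)),
    taylorPowerSeries_mul analyticAt_id (hh.mul h2),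
    taylorPowerSeries_mul hh h2, taylorPowerSeries_add (hc _) h1, taylorPowerSeries_mul (hc _) hg]
  simp only [taylorPowerSeries_const, taylorPowerSeries_id, map_neg, map_one]
  ring

open PowerSeries in
theorem coeff_of_schur_step {G H : PowerSeries ℂ} {c d : ℂ}
    (e : G = C c + X * (H * (1 - C d * G))) :
    coeff 0 G = c ∧ coeff 1 G = coeff 0 H * (1 - d * c) ∧
    coeff 2 G = coeff 1 H * (1 - d * c) - d * coeff 0 H * coeff 1 G ∧
    coeff 3 G = coeff 2 H * (1 - d * c) - d * (coeff 1 H * coeff 1 G + coeff 0 H * coeff 2 G) := by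
  have h0 : coeff 0 G = c := by rw [e]; simp
  have hn : ∀ n, coeff (n+1) G = coeff n (H * (1 - C d * G)) := fun n => by
    conv_lhs => rw [e]
    simp [coeff_succ_X_mul]
  refine ⟨h0, ?_, ?_, ?_⟩ <;> rw [hn] <;>
    simp [coeff_mul, Finset.Nat.antidiagonal_succ, coeff_one, -coeff_zero_eq_constantCoeff,
      h0] <;> ring

open PowerSeries in
theorem coeff_of_convex_ode {F W : PowerSeries ℂ} (h0 : coeff 0 W = 0) (h1 : coeff 1 F = 1)
    (e : X * derivative ℂ (derivative ℂ F) = derivative ℂ F * (W + C (1/4) * (W * W))) :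
    2 * coeff 2 F = coeff 1 W ∧
    6 * coeff 3 F = coeff 2 W + coeff 1 W ^ 2 / 4 + 2 * coeff 2 F * coeff 1 W ∧
    12 * coeff 4 F = coeff 3 W + coeff 1 W * coeff 2 W / 2
      + 2 * coeff 2 F * (coeff 2 W + coeff 1 W ^ 2 / 4) + 3 * coeff 3 F * coeff 1 W ∧
    20 * coeff 5 F = coeff 4 W + (2 * coeff 1 W * coeff 3 W + coeff 2 W ^ 2) / 4
      + 2 * coeff 2 F * (coeff 3 W + coeff 1 W * coeff 2 W / 2)
      + 3 * coeff 3 F * (coeff 2 W + coeff 1 W ^ 2 / 4) + 4 * coeff 4 F * coeff 1 W := by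
  have hn : ∀ n, coeff n (derivative ℂ (derivative ℂ F)) =
      coeff (n + 1) (derivative ℂ F * (W + C (1/4) * (W * W))) := fun n => by
    rw [← e, coeff_succ_X_mul]
  have e0 := hn 0
  have e1 := hn 1
  have e2 := hn 2
  have e3 := hn 3
  simp [coeff_mul, Finset.Nat.antidiagonal_succ, -coeff_zero_eq_constantCoeff, coeff_derivative,
    h0, h1] at e0 e1 e2 e3
  refine ⟨?_, ?_, ?_, ?_⟩
  · linear_combination e0
  · linear_combination e1
  · linear_combination e2
  · linear_combination e3

/-- The Hankel determinant in terms of the Taylor coefficients of the Schwarz function. -/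
theorem hankel_eq_schwarz_coeff {a2 a3 a4 a5 c1 c2 c3 c4 : ℂ} (h2 : 2 * a2 = c1)
    (h3 : 6 * a3 = c2 + c1 ^ 2 / 4 + 2 * a2 * c1)
    (h4 : 12 * a4 = c3 + c1 * c2 / 2 + 2 * a2 * (c2 + c1 ^ 2 / 4) + 3 * a3 * c1)
    (h5 : 20 * a5 = c4 + (2 * c1 * c3 + c2 ^ 2) / 4 + 2 * a2 * (c3 + c1 * c2 / 2)
      + 3 * a3 * (c2 + c1 ^ 2 / 4) + 4 * a4 * c1) :
    a3 * (a2 * a4 - a3 ^ 2) - a4 * (a4 - a2 * a3) + a5 * (a3 - a2 ^ 2) =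
      1 / 144 * (-(7/480)*c1^6 + 7/80*c1^4*c2 + 1/5*c1^3*c3 - 17/40*c1^2*c2^2 - 3/10*c1^2*c4
        + 1/5*c1*c2*c3 + 7/30*c2^3 + 6/5*c2*c4 - c3^2) := by
  obtain rfl : a2 = c1 / 2 := by linear_combination h2 / 2
  obtain rfl : a3 = (c2 + c1 ^ 2 / 4 + 2 * (c1 / 2) * c1) / 6 := by linear_combination h3 / 6
  obtain rfl : a4 = (c3 + c1 * c2 / 2 + 2 * (c1 / 2) * (c2 + c1 ^ 2 / 4) +
    3 * ((c2 + c1 ^ 2 / 4 + 2 * (c1 / 2) * c1) / 6) * c1) / 12 := by linear_combination h4 / 12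
  rw [show a5 = (20 * a5) / 20 by ring, h5]
  ring

/-- **Third Hankel determinant bound for the class `C(φ)`, `φ(z) = (1 + z/2)²`.**
If `f` is analytic on the unit disk with Taylor expansion `f(z) = z + Σ_{n≥2} aₙ zⁿ`,
and there is a Schwarz function `ω` with `z f''(z) = f'(z) (φ(ω(z)) − 1)` on the disk
(i.e. `f ∈ C(φ)`), then `|H₃(1)| = |a₃(a₂a₄ − a₃²) − a₄(a₄ − a₂a₃) + a₅(a₃ − a₂²)| ≤ 1/144`. -/
theorem third_hankel_bound
    (f : ℂ → ℂ) (a : ℕ → ℂ) (ω : ℂ → ℂ)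
    (hf : AnalyticOnNhd ℂ f (ball (0:ℂ) 1))
    (ha : ∀ z ∈ ball (0:ℂ) 1, HasSum (fun n => a n * z ^ n) (f z))
    (ha0 : a 0 = 0) (ha1 : a 1 = 1)
    (hω : AnalyticOnNhd ℂ ω (ball (0:ℂ) 1))
    (hω0 : ω 0 = 0)
    (hω1 : ∀ z ∈ ball (0:ℂ) 1, ‖ω z‖ < 1)
    (hsub : ∀ z ∈ ball (0:ℂ) 1,
      z * deriv (deriv f) z = deriv f z * ((1 + ω z / 2) ^ 2 - 1)) :
    ‖a 3 * (a 2 * a 4 - a 3 ^ 2) - a 4 * (a 4 - a 2 * a 3) + a 5 * (a 3 - a 2 ^ 2)‖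
      ≤ 1 / 144 := by
  have h0 : (0:ℂ) ∈ ball (0:ℂ) 1 := mem_ball_self one_pos
  have han : ∀ {g : ℂ → ℂ}, DifferentiableOn ℂ g (ball 0 1) → AnalyticAt ℂ g 0 :=
    fun hg => hg.analyticAt (ball_mem_nhds _ one_pos)
  obtain ⟨g, hg, hg1, eg⟩ := exists_schur_step ω hω.differentiableOn fun z hz => (hω1 z hz).le
  obtain ⟨h, hh, hh1, eh⟩ := exists_schur_step g hg hg1
  obtain ⟨k, hk, hk1, ek⟩ := exists_schur_step h hh hh1
  obtain ⟨l, hl, hl1, el⟩ := exists_schur_step k hk hk1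
  have hWan := hω 0 h0
  have hf1 := (hf 0 h0).deriv
  have hc : AnalyticAt ℂ (fun _ : ℂ => (1/4:ℂ)) 0 := analyticAt_const
  have hode : PowerSeries.X * PowerSeries.derivative ℂ
      (PowerSeries.derivative ℂ (taylorPowerSeries f)) =
      PowerSeries.derivative ℂ (taylorPowerSeries f) * (taylorPowerSeries ω +
        PowerSeries.C (1/4) * (taylorPowerSeries ω * taylorPowerSeries ω)) := by
    rw [← taylorPowerSeries_deriv, ← taylorPowerSeries_deriv, ← taylorPowerSeries_id,
      ← taylorPowerSeries_const, ← taylorPowerSeries_mul hWan hWan,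
      ← taylorPowerSeries_mul hc (hWan.mul hWan),
      ← taylorPowerSeries_add hWan (hc.mul (hWan.mul hWan)),
      ← taylorPowerSeries_mul hf1 (hWan.add (hc.mul (hWan.mul hWan))),
      ← taylorPowerSeries_mul analyticAt_id hf1.deriv]
    refine taylorPowerSeries_congr fun z hz => ?_
    simp only [Pi.add_apply, Pi.mul_apply, id]
    linear_combination hsub z hz
  have hW : taylorPowerSeries ω = PowerSeries.X * taylorPowerSeries g := by
    simpa [hω0] using taylorPowerSeries_of_schur_step hWan (han hg) eg
  have hW0 : PowerSeries.coeff 0 (taylorPowerSeries ω) = 0 := by simp [hW]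
  have hWn : ∀ n, PowerSeries.coeff (n + 1) (taylorPowerSeries ω) =
      PowerSeries.coeff n (taylorPowerSeries g) := fun n => by
    rw [hW, PowerSeries.coeff_succ_X_mul]
  obtain ⟨g_zero, g_one, g_two, g_three⟩ :=
    coeff_of_schur_step (taylorPowerSeries_of_schur_step (han hg) (han hh) eh)
  obtain ⟨h_zero, h_one, h_two, -⟩ :=
    coeff_of_schur_step (taylorPowerSeries_of_schur_step (han hh) (han hk) ek)
  obtain ⟨k_zero, k_one, -, -⟩ :=
    coeff_of_schur_step (taylorPowerSeries_of_schur_step (han hk) (han hl) el)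
  have l_zero : PowerSeries.coeff 0 (taylorPowerSeries l) = l 0 := by
    rw [taylorPowerSeries, PowerSeries.coeff_mk]
    simp
  obtain ⟨a_two, a_three, a_four, a_five⟩ :=
    coeff_of_convex_ode hW0 ((coeff_taylorPowerSeries_of_hasSum ha 1).trans ha1) hode
  simp only [coeff_taylorPowerSeries_of_hasSum ha, hWn] at a_two a_three a_four a_five
  rw [hankel_eq_schwarz_coeff a_two a_three a_four a_five, norm_mul]
  refine (mul_le_of_le_one_right (norm_nonneg _) ?_).trans_eq (by norm_num)
  refine le_of_eq_of_le (congrArg norm ?_)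
    (norm_schur_expression_le_one (g 0) (h 0) (k 0) (l 0)
      (hg1 0 h0) (hh1 0 h0) (hk1 0 h0) (hl1 0 h0))
  rw [g_three, g_two, g_one, g_zero, h_two, h_one, h_zero, k_one, k_zero, l_zero]
  ring
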